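/- Let G be a bipartite graph and let (T, G(·)) be a branching tree for G. If some node p of T at depth 2s is such that G(p) contains at least one edge, then G contains an induced half-graph of order s+1. Consequently, if G contains no induced half-graph of order t+1, then the height of T is at most 2t. -/

import Mathlib

/-- A finite bipartite graph: two disjoint finite sides `A`, `B` and an edge
set `E ⊆ A ×ˢ B`. -/
structure BipGraph (V : Type) [DecidableEq V] where
  A : Finset V
  B : Finset V
  disj : Disjoint A B
  E : Finset (V × V)
  E_sub : E ⊆ A ×ˢ B

namespace BipGraph

variable {V : Type} [DecidableEq V]

/-- The set of neighbors of a vertex. -/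
def nbr (G : BipGraph V) (v : V) : Finset V :=
  (G.A ∪ G.B).filter (fun w => (v, w) ∈ G.E ∨ (w, v) ∈ G.E)

/-- Adjacency in a bipartite graph. -/
def adj (G : BipGraph V) (u v : V) : Prop :=
  (u, v) ∈ G.E ∨ (v, u) ∈ G.E

/-- The bipartite complement of `G`. -/
def bipCompl (G : BipGraph V) : BipGraph V where
  A := G.A
  B := G.B
  disj := G.disj
  E := (G.A ×ˢ G.B) \ G.E
  E_sub := Finset.sdiff_subset

/-- The graph obtained from `G` by deleting all isolated vertices. -/
def removeIsolated (G : BipGraph V) : BipGraph V where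
  A := G.A.filter (fun v => (G.nbr v).Nonempty)
  B := G.B.filter (fun v => (G.nbr v).Nonempty)
  disj := Disjoint.mono (Finset.filter_subset _ _) (Finset.filter_subset _ _) G.disj
  E := G.E
  E_sub := by
    intro e he
    have h1 := G.E_sub he
    rw [Finset.mem_product] at h1 ⊢
    have he' : (e.1, e.2) ∈ G.E := by simpa using he
    constructor
    · exact Finset.mem_filter.mpr ⟨h1.1, ⟨e.2,
        Finset.mem_filter.mpr ⟨Finset.mem_union_right _ h1.2, Or.inl he'⟩⟩⟩
    · exact Finset.mem_filter.mpr ⟨h1.2, ⟨e.1,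
        Finset.mem_filter.mpr ⟨Finset.mem_union_left _ h1.1, Or.inr he'⟩⟩⟩

/-- `H` is an induced subgraph of `G`. -/
def IsInducedSubgraph (H G : BipGraph V) : Prop :=
  H.A ⊆ G.A ∧ H.B ⊆ G.B ∧ H.E = G.E.filter (fun e => e.1 ∈ H.A ∧ e.2 ∈ H.B)

end BipGraph

/-- A left branching of `G`. -/
structure IsLeftBranching {V : Type} [DecidableEq V] (G : BipGraph V) {m : ℕ}
    (H : Fin m → BipGraph V) (ℓ : Fin m → V) : Prop where
  induced : ∀ i, (H i).IsInducedSubgraph G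
  leaders_inj : Function.Injective ℓ
  leader_mem : ∀ i, ℓ i ∈ (H i).A
  leader_dom : ∀ i, ∀ v ∈ (H i).B, (ℓ i, v) ∈ (H i).E
  edge_cover : ∀ e ∈ G.E, ∃ i, e ∈ (H i).E
  right_disj : ∀ i j, i ≠ j → Disjoint (H i).B (H j).B
  right_union : Finset.univ.biUnion (fun i => (H i).B) = G.B

/-- A right branching of `G` (the roles of the two sides exchanged). -/
structure IsRightBranching {V : Type} [DecidableEq V] (G : BipGraph V) {m : ℕ}
    (H : Fin m → BipGraph V) (ℓ : Fin m → V) : Prop where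
  induced : ∀ i, (H i).IsInducedSubgraph G
  leaders_inj : Function.Injective ℓ
  leader_mem : ∀ i, ℓ i ∈ (H i).B
  leader_dom : ∀ i, ∀ u ∈ (H i).A, (u, ℓ i) ∈ (H i).E
  edge_cover : ∀ e ∈ G.E, ∃ i, e ∈ (H i).E
  left_disj : ∀ i j, i ≠ j → Disjoint (H i).A (H j).A
  left_union : Finset.univ.biUnion (fun i => (H i).A) = G.A

/-- A branching tree for a bipartite graph `G`: a finite rooted tree whose
nodes carry bipartite graphs (with sides contained in those of `G`); the root
carries `G`, a node is a leaf iff its graph is edgeless, and the children of a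
non-leaf node `p` carry exactly the bipartite complements of the branches of a
left branching (if `depth p` is even) or a right branching (if `depth p` is
odd) of the graph of `p` with isolated vertices deleted. -/
structure BranchingTree (V : Type) [DecidableEq V] (G : BipGraph V) where
  ι : Type
  fintype : Fintype ι
  root : ι
  parent : ι → ι
  depth : ι → ℕ
  Gr : ι → BipGraph V
  root_depth : depth root = 0
  parent_depth : ∀ p, p ≠ root → depth (parent p) + 1 = depth p
  root_graph : Gr root = G
  sides : ∀ p, (Gr p).A ⊆ G.A ∧ (Gr p).B ⊆ G.B
  leaf_no_children : ∀ p, (Gr p).E = ∅ → ∀ q, q ≠ root → parent q ≠ p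
  branch : ∀ p, (Gr p).E ≠ ∅ →
    ∃ (m : ℕ) (H : Fin m → BipGraph V) (ℓ : Fin m → V) (child : Fin m → ι),
      (Even (depth p) → IsLeftBranching ((Gr p).removeIsolated) H ℓ) ∧
      (¬ Even (depth p) → IsRightBranching ((Gr p).removeIsolated) H ℓ) ∧
      Function.Injective child ∧
      (∀ i, child i ≠ root ∧ parent (child i) = p) ∧
      (∀ q, q ≠ root → parent q = p → ∃ i, q = child i) ∧
      (∀ i, Gr (child i) = (H i).bipCompl)

/-- `G` contains the half-graph of order `t` as an induced subgraph. -/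
def HasInducedHalfGraph {V : Type} [DecidableEq V] (G : BipGraph V) (t : ℕ) : Prop :=
  ∃ u v : Fin t → V, Function.Injective u ∧ Function.Injective v ∧
    (∀ i, u i ∈ G.A) ∧ (∀ j, v j ∈ G.B) ∧
    (∀ i j, G.adj (u i) (v j) ↔ i ≤ j)

namespace BipGraph

variable {V : Type} [DecidableEq V]

theorem adj_iff_mem (G : BipGraph V) {a b : V} (ha : a ∈ G.A) : G.adj a b ↔ (a, b) ∈ G.E := by
  refine ⟨fun h => h.resolve_right fun h' => ?_, Or.inl⟩
  exact Finset.disjoint_left.mp G.disj ha (Finset.mem_product.mp (G.E_sub h')).2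

theorem IsInducedSubgraph.mem_iff {H G : BipGraph V} (h : H.IsInducedSubgraph G) {a b : V}
    (ha : a ∈ H.A) (hb : b ∈ H.B) : (a, b) ∈ H.E ↔ (a, b) ∈ G.E := by
  rw [h.2.2, Finset.mem_filter]
  exact and_iff_left ⟨ha, hb⟩

theorem mem_bipCompl_iff (H : BipGraph V) {a b : V} (ha : a ∈ H.A) (hb : b ∈ H.B) :
    (a, b) ∈ H.bipCompl.E ↔ (a, b) ∉ H.E := by
  simp [bipCompl, ha, hb]

/-- `K` is the bipartite complement of an induced subgraph of `G`. -/
def IsComplOfInduced (K G : BipGraph V) : Prop :=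
  K.A ⊆ G.A ∧ K.B ⊆ G.B ∧ ∀ a ∈ K.A, ∀ b ∈ K.B, (a, b) ∈ K.E ↔ (a, b) ∉ G.E

theorem IsInducedSubgraph.isComplOfInduced {H G : BipGraph V}
    (h : H.IsInducedSubgraph G.removeIsolated) : H.bipCompl.IsComplOfInduced G :=
  ⟨h.1.trans (Finset.filter_subset _ _), h.2.1.trans (Finset.filter_subset _ _),
    fun _ ha _ hb => (H.mem_bipCompl_iff ha hb).trans (not_congr (h.mem_iff ha hb))⟩

end BipGraph

/-- A half-graph of order `k` in `G` whose vertices `u i` are adjacent to the whole right side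
of `K`, and whose vertices `v j` are adjacent to no left vertex of `K`, where `K` is an induced
subgraph of `G`. -/
structure IsHalfGraphOver {V : Type} [DecidableEq V] (G K : BipGraph V) (k : ℕ)
    (u v : ℕ → V) : Prop where
  left_subset : K.A ⊆ G.A
  right_subset : K.B ⊆ G.B
  mem_iff : ∀ a ∈ K.A, ∀ b ∈ K.B, (a, b) ∈ K.E ↔ (a, b) ∈ G.E
  left_mem : ∀ i < k, u i ∈ G.A
  right_mem : ∀ j < k, v j ∈ G.B
  edge_iff : ∀ i < k, ∀ j < k, (u i, v j) ∈ G.E ↔ i ≤ j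
  left_dom : ∀ i < k, ∀ b ∈ K.B, (u i, b) ∈ G.E
  right_anti : ∀ j < k, ∀ a ∈ K.A, (a, v j) ∉ G.E

namespace IsHalfGraphOver

variable {V : Type} [DecidableEq V] {G K : BipGraph V} {k : ℕ} {u v : ℕ → V}

theorem extend (h : IsHalfGraphOver G K k u v) {K' : BipGraph V} {a b : V}
    (hA : K'.A ⊆ K.A) (hB : K'.B ⊆ K.B)
    (hE : ∀ x ∈ K'.A, ∀ y ∈ K'.B, (x, y) ∈ K'.E ↔ (x, y) ∈ G.E)
    (ha : a ∈ K.A) (hb : b ∈ K.B) (hab : (a, b) ∈ G.E)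
    (hdom : ∀ y ∈ K'.B, (a, y) ∈ G.E) (hanti : ∀ x ∈ K'.A, (x, b) ∉ G.E) :
    IsHalfGraphOver G K' (k + 1) (Function.update u k a) (Function.update v k b) where
  left_subset := hA.trans h.left_subset
  right_subset := hB.trans h.right_subset
  mem_iff := hE
  left_mem i hi := by
    rcases Nat.lt_succ_iff_lt_or_eq.mp hi with hi | rfl
    · simpa [hi.ne] using h.left_mem i hi
    · simpa using h.left_subset ha
  right_mem i hi := by
    rcases Nat.lt_succ_iff_lt_or_eq.mp hi with hi | rfl
    · simpa [hi.ne] using h.right_mem i hi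
    · simpa using h.right_subset hb
  edge_iff i hi j hj := by
    rcases Nat.lt_succ_iff_lt_or_eq.mp hi with hi | rfl <;>
      rcases Nat.lt_succ_iff_lt_or_eq.mp hj with hj | rfl
    · simpa [hi.ne, hj.ne] using h.edge_iff i hi j hj
    · simpa [hi.ne, hi.le] using h.left_dom i hi b hb
    · simpa [hj.ne, hj.not_ge] using h.right_anti j hj a ha
    · simpa using hab
  left_dom i hi y hy := by
    rcases Nat.lt_succ_iff_lt_or_eq.mp hi with hi | rfl
    · simpa [hi.ne] using h.left_dom i hi y (hB hy)
    · simpa using hdom y hy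
  right_anti i hi x hx := by
    rcases Nat.lt_succ_iff_lt_or_eq.mp hi with hi | rfl
    · simpa [hi.ne] using h.right_anti i hi x (hA hx)
    · simpa using hanti x hx

theorem hasInducedHalfGraph (h : IsHalfGraphOver G K k u v) : HasInducedHalfGraph G k := by
  have hadj : ∀ i j : Fin k, G.adj (u i) (v j) ↔ i ≤ j := fun i j =>
    (G.adj_iff_mem (h.left_mem i i.2)).trans (h.edge_iff i i.2 j j.2)
  refine ⟨fun i => u i, fun j => v j, fun i j hij => ?_, fun i j hij => ?_,
    fun i => h.left_mem i i.2, fun j => h.right_mem j j.2, hadj⟩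
  · have hij : u i = u j := hij
    exact le_antisymm ((hadj i j).mp (hij ▸ (hadj j j).mpr le_rfl))
      ((hadj j i).mp (hij ▸ (hadj i i).mpr le_rfl))
  · have hij : v i = v j := hij
    exact le_antisymm ((hadj i j).mp (hij ▸ (hadj i i).mpr le_rfl))
      ((hadj j i).mp (hij ▸ (hadj j j).mpr le_rfl))

/-- Any edge of `K` extends a half-graph over `K`. -/
theorem hasInducedHalfGraph_succ (h : IsHalfGraphOver G K k u v) (hK : K.E.Nonempty) :
    HasInducedHalfGraph G (k + 1) := by
  obtain ⟨⟨a, b⟩, hab⟩ := hK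
  obtain ⟨ha, hb⟩ := Finset.mem_product.mp (K.E_sub hab)
  let K' : BipGraph V := ⟨∅, ∅, by simp, ∅, by simp⟩
  exact (h.extend (K' := K') (by simp [K']) (by simp [K']) (by simp [K']) ha hb
    ((h.mem_iff a ha b hb).mp hab) (by simp [K']) (by simp [K'])).hasInducedHalfGraph

end IsHalfGraphOver

namespace BranchingTree

variable {V : Type} [DecidableEq V] {G : BipGraph V} (T : BranchingTree V G)

theorem exists_parent {p : T.ι} {n : ℕ} (hp : T.depth p = n + 1) :
    p ≠ T.root ∧ T.depth (T.parent p) = n := by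
  have hne : p ≠ T.root := by
    rintro rfl
    have := T.root_depth
    omega
  have := T.parent_depth p hne
  exact ⟨hne, by omega⟩

theorem parent_edges_ne_empty {q : T.ι} (hq : q ≠ T.root) : (T.Gr (T.parent q)).E ≠ ∅ :=
  fun h => T.leaf_no_children _ h q hq rfl

theorem exists_left_leader {q : T.ι} (hq : q ≠ T.root) (heven : Even (T.depth (T.parent q))) :
    (T.Gr q).IsComplOfInduced (T.Gr (T.parent q)) ∧
      ∃ a ∈ (T.Gr q).A, ∀ b ∈ (T.Gr q).B, (a, b) ∈ (T.Gr (T.parent q)).E := by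
  obtain ⟨m, H, ℓ, child, hl, -, -, -, hsurj, hGr⟩ := T.branch _ (T.parent_edges_ne_empty hq)
  obtain ⟨i, hi⟩ := hsurj q hq rfl
  have hH := hl heven
  have hGq : T.Gr q = (H i).bipCompl := by rw [← hGr i, ← hi]
  rw [hGq]
  exact ⟨(hH.induced i).isComplOfInduced, ℓ i, hH.leader_mem i, fun b hb =>
    ((hH.induced i).mem_iff (hH.leader_mem i) hb).mp (hH.leader_dom i b hb)⟩

theorem exists_right_leader {q : T.ι} (hq : q ≠ T.root)
    (hodd : ¬ Even (T.depth (T.parent q))) :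
    (T.Gr q).IsComplOfInduced (T.Gr (T.parent q)) ∧
      ∃ b ∈ (T.Gr q).B, ∀ a ∈ (T.Gr q).A, (a, b) ∈ (T.Gr (T.parent q)).E := by
  obtain ⟨m, H, ℓ, child, -, hr, -, -, hsurj, hGr⟩ := T.branch _ (T.parent_edges_ne_empty hq)
  obtain ⟨i, hi⟩ := hsurj q hq rfl
  have hH := hr hodd
  have hGq : T.Gr q = (H i).bipCompl := by rw [← hGr i, ← hi]
  rw [hGq]
  exact ⟨(hH.induced i).isComplOfInduced, ℓ i, hH.leader_mem i, fun a ha =>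
    ((hH.induced i).mem_iff ha (hH.leader_mem i)).mp (hH.leader_dom i a ha)⟩

/-- The leaders on the path from the root to a node at depth `2 s` form a half-graph. -/
theorem exists_isHalfGraphOver [Nonempty V] (s : ℕ) : ∀ p : T.ι, T.depth p = 2 * s →
    ∃ u v : ℕ → V, IsHalfGraphOver G (T.Gr p) s u v := by
  induction s with
  | zero =>
    intro p hp
    have hroot : p = T.root := by
      by_contra hne
      have := T.parent_depth p hne
      omega
    have hG : T.Gr p = G := hroot ▸ T.root_graph
    obtain ⟨x⟩ := ‹Nonempty V›
    exact ⟨fun _ => x, fun _ => x, by constructor <;> simp [hG]⟩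
  | succ s ih =>
    intro p hp
    obtain ⟨hp_ne, hq⟩ := T.exists_parent (n := 2 * s + 1) hp
    obtain ⟨hq_ne, hr⟩ := T.exists_parent hq
    obtain ⟨u, v, h⟩ := ih _ hr
    obtain ⟨⟨hqA, hqB, hqE⟩, a, ha, hdom⟩ :=
      T.exists_left_leader hq_ne (by rw [hr]; exact even_two_mul s)
    obtain ⟨⟨hpA, hpB, hpE⟩, b, hb, hanti⟩ :=
      T.exists_right_leader hp_ne (by rw [hq]; simp [parity_simps])
    have hmem : ∀ x ∈ (T.Gr (T.parent p)).A, ∀ y ∈ (T.Gr (T.parent p)).B,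
        (x, y) ∈ (T.Gr (T.parent p)).E ↔ (x, y) ∉ G.E := fun x hx y hy =>
      (hqE x hx y hy).trans (not_congr (h.mem_iff x (hqA hx) y (hqB hy)))
    have hdomG : ∀ y ∈ (T.Gr (T.parent p)).B, (a, y) ∈ G.E := fun y hy =>
      (h.mem_iff a (hqA ha) y (hqB hy)).mp (hdom y hy)
    refine ⟨_, _, h.extend (hpA.trans hqA) (hpB.trans hqB) (fun x hx y hy => ?_) (hqA ha)
      (hqB (hpB hb)) (hdomG b (hpB hb)) (fun y hy => hdomG y (hpB hy)) fun x hx =>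
        (hmem x (hpA hx) b (hpB hb)).mp (hanti x hx)⟩
    rw [hpE x hx y hy, hmem x (hpA hx) y (hpB hy), not_not]

theorem exists_ancestor (n : ℕ) : ∀ (d : ℕ) (p : T.ι), T.depth p = n + 1 + d →
    ∃ q, q ≠ T.root ∧ T.depth (T.parent q) = n := by
  intro d
  induction d with
  | zero => exact fun p hp => ⟨p, T.exists_parent hp⟩
  | succ d ih => exact fun p hp => ih _ (T.exists_parent hp).2

end BranchingTree

/-- If some node at depth `2 s` of a branching tree of `G` carries a graph
with an edge, then `G` contains an induced half-graph of order `s + 1`;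
consequently, if `G` has no induced half-graph of order `t + 1`, then the
branching tree has height at most `2 t`. -/
theorem branching_tree_height
    (V : Type) [DecidableEq V] (G : BipGraph V) (T : BranchingTree V G) :
    (∀ (s : ℕ) (p : T.ι), T.depth p = 2 * s → (T.Gr p).E.Nonempty →
        HasInducedHalfGraph G (s + 1)) ∧
    (∀ t : ℕ, ¬ HasInducedHalfGraph G (t + 1) → ∀ p : T.ι, T.depth p ≤ 2 * t) := by
  have main : ∀ (s : ℕ) (p : T.ι), T.depth p = 2 * s → (T.Gr p).E.Nonempty →
      HasInducedHalfGraph G (s + 1) := by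
    intro s p hp hE
    have : Nonempty V := ⟨hE.choose.1⟩
    obtain ⟨u, v, h⟩ := T.exists_isHalfGraphOver s p hp
    exact h.hasInducedHalfGraph_succ hE
  refine ⟨main, fun t ht p => ?_⟩
  by_contra! hlt
  obtain ⟨q, hq, hdepth⟩ := T.exists_ancestor (2 * t) (T.depth p - (2 * t + 1)) p (by omega)
  exact ht (main t _ hdepth (Finset.nonempty_iff_ne_empty.mpr (T.parent_edges_ne_empty hq)))
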